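/- Let n > 10 be an integer, p > p_c and α > 0. Suppose v₀ : [0,∞) → ℝ is continuous with 0 ≤ v₀(r) ≤ L r^{−ν} for all r > 0, φ_α(r) ≤ v₀(r) for all r ≥ 0, and v₀(r) ≤ φ_α(r) + b r^{−γ} for all r > 1, with some b > 0 and γ ∈ (ν+λ₁, (n−2)/2). Then for every α' > α one can find t₀ ≥ 0 such that every bounded classical radial solution v of (v^p)_t = v_rr + ((n−1)/r)v_r + v^p with initial data v₀ satisfies v(r,t) ≤ φ_{α'}(r) for all r ≥ 0 and t ≥ t₀. -/

import Mathlib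

noncomputable section

open Real Filter Set Asymptotics

/-- `ν = 2/(p-1)`. -/
def nuExp (p : ℝ) : ℝ := 2 / (p - 1)

/-- `L = (ν(n−2−ν))^{1/(p−1)}`. -/
def Lconst (n : ℕ) (p : ℝ) : ℝ := (nuExp p * ((n : ℝ) - 2 - nuExp p)) ^ (1 / (p - 1))

/-- The critical exponent `p_c` for `n > 10`. -/
def pc (n : ℕ) : ℝ :=
  (((n : ℝ) - 2) ^ 2 - 4 * (n : ℝ) + 8 * Real.sqrt ((n : ℝ) - 1)) /
    (((n : ℝ) - 2) * ((n : ℝ) - 10))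

/-- `λ₁ = (n−2−2ν − √((n−2−2ν)² − 8(n−2−ν)))/2`. -/
def lam1 (n : ℕ) (p : ℝ) : ℝ :=
  (((n : ℝ) - 2 - 2 * nuExp p) -
    Real.sqrt (((n : ℝ) - 2 - 2 * nuExp p) ^ 2 - 8 * ((n : ℝ) - 2 - nuExp p))) / 2

/-- `κ(γ) = γ(n−2−γ)/(pL^{p−1}) − 1`. -/
def kappaOf (n : ℕ) (p γ : ℝ) : ℝ :=
  γ * ((n : ℝ) - 2 - γ) / (p * Lconst n p ^ (p - 1)) - 1

/-- `φ` is the (radial profile of the) positive steady state `φ_α` of `Δφ + φ^p = 0`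
with `φ(0) = α`, `φ'(0) = 0`, together with its properties in the supercritical range
`n > 10`, `p > p_c`: positivity, strict monotonicity, the bound `φ(r) ≤ L r^{−ν}`, and the
asymptotic expansion `φ(r) = L r^{−ν} − a r^{−ν−λ₁} + o(r^{−ν−λ₁})` with coefficient `a > 0`. -/
structure IsSteadyStateA (n : ℕ) (p α : ℝ) (φ : ℝ → ℝ) (a : ℝ) : Prop where
  cont : ContinuousOn φ (Set.Ici 0)
  smooth : ContDiffOn ℝ 2 φ (Set.Ioi 0)
  ode : ∀ r > (0 : ℝ), deriv (deriv φ) r + ((n : ℝ) - 1) / r * deriv φ r + φ r ^ p = 0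
  val0 : φ 0 = α
  deriv0 : derivWithin φ (Set.Ici 0) 0 = 0
  pos : ∀ r ≥ (0 : ℝ), 0 < φ r
  anti : StrictAntiOn φ (Set.Ici 0)
  upper : ∀ r > (0 : ℝ), φ r ≤ Lconst n p * r ^ (-nuExp p)
  a_pos : 0 < a
  expansion :
    (fun r => φ r - (Lconst n p * r ^ (-nuExp p) - a * r ^ (-nuExp p - lam1 n p)))
      =o[atTop] fun r => r ^ (-nuExp p - lam1 n p)

/-- `v` is a bounded classical radial solution of
`(v^p)_t = v_rr + ((n−1)/r) v_r + v^p` with initial data `v₀ : [0,∞) → ℝ`: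
nonnegative and continuous on `[0,∞) × [0,∞)`, bounded on `[0,∞) × [0,T]` for every
`T > 0`, `C²` in `r` and `C¹` in `t` for `t > 0` with `∂_r v(0,t) = 0`, satisfying the
equation pointwise for `r > 0`, `t > 0`, and attaining the initial data. -/
structure IsRadialSol (n : ℕ) (p : ℝ) (v : ℝ → ℝ → ℝ) (v₀ : ℝ → ℝ) : Prop where
  nonneg : ∀ r ≥ (0 : ℝ), ∀ t ≥ (0 : ℝ), 0 ≤ v r t
  cont : ContinuousOn (fun q : ℝ × ℝ => v q.1 q.2) (Set.Ici 0 ×ˢ Set.Ici 0)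
  bdd : ∀ T > (0 : ℝ), ∃ M, ∀ r ≥ (0 : ℝ), ∀ t ∈ Set.Icc (0 : ℝ) T, v r t ≤ M
  smooth_r : ∀ t > (0 : ℝ), ContDiffOn ℝ 2 (fun r => v r t) (Set.Ici 0)
  smooth_t : ∀ r ≥ (0 : ℝ), ContDiffOn ℝ 1 (fun s => v r s ^ p) (Set.Ioi (0 : ℝ))
  slope0 : ∀ t > (0 : ℝ), derivWithin (fun r => v r t) (Set.Ici 0) 0 = 0
  pde : ∀ r > (0 : ℝ), ∀ t > (0 : ℝ),
    deriv (fun s => v r s ^ p) t =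
      deriv (deriv fun ρ => v ρ t) r + ((n : ℝ) - 1) / r * deriv (fun ρ => v ρ t) r
        + v r t ^ p
  init : ∀ r ≥ (0 : ℝ), v r 0 = v₀ r

open Topology

def C2p (f f1 f2 : ℝ → ℝ) : Prop :=
  ∀ r, 0 < r → HasDerivAt f (f1 r) r ∧ HasDerivAt f1 (f2 r) r

theorem C2p.add {f f1 f2 g g1 g2 : ℝ → ℝ} (hf : C2p f f1 f2) (hg : C2p g g1 g2) :
    C2p (fun r => f r + g r) (fun r => f1 r + g1 r) (fun r => f2 r + g2 r) :=
  fun r hr => ⟨(hf r hr).1.add (hg r hr).1, (hf r hr).2.add (hg r hr).2⟩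

theorem C2p.smul {f f1 f2 : ℝ → ℝ} (c : ℝ) (hf : C2p f f1 f2) :
    C2p (fun r => c * f r) (fun r => c * f1 r) (fun r => c * f2 r) :=
  fun r hr => ⟨(hf r hr).1.const_mul c, (hf r hr).2.const_mul c⟩

theorem C2p.sub {f f1 f2 g g1 g2 : ℝ → ℝ} (hf : C2p f f1 f2) (hg : C2p g g1 g2) :
    C2p (fun r => f r - g r) (fun r => f1 r - g1 r) (fun r => f2 r - g2 r) :=
  fun r hr => ⟨(hf r hr).1.sub (hg r hr).1, (hf r hr).2.sub (hg r hr).2⟩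

theorem C2p.const (c : ℝ) : C2p (fun _ => c) (fun _ => 0) (fun _ => 0) :=
  fun r _ => ⟨hasDerivAt_const r c, hasDerivAt_const r 0⟩

theorem C2p.id : C2p (fun r => r) (fun _ => 1) (fun _ => 0) :=
  fun r _ => ⟨hasDerivAt_id r, hasDerivAt_const r 1⟩

theorem C2p.exp (A : ℝ) : C2p (fun r => Real.exp (-A * r)) (fun r => -A * Real.exp (-A * r))
    (fun r => A ^ 2 * Real.exp (-A * r)) := by
  have h : ∀ r, HasDerivAt (fun r => Real.exp (-A * r)) (-A * Real.exp (-A * r)) r := by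
    intro r
    have := ((hasDerivAt_id r).const_mul (-A)).exp
    simpa [mul_comm] using this
  refine fun r _ => ⟨h r, ?_⟩
  exact ((h r).const_mul (-A)).congr_deriv (by ring)

theorem C2p.pow (s : ℝ) : C2p (fun r => r ^ (-s)) (fun r => -s * r ^ (-s) / r)
    (fun r => s * (s + 1) * r ^ (-s) / r ^ 2) := by
  have h : ∀ r, 0 < r → HasDerivAt (fun r : ℝ => r ^ (-s)) (-s * r ^ (-s) / r) r := by
    intro r hr
    have := Real.hasDerivAt_rpow_const (x := r) (p := -s) (Or.inl hr.ne')
    rw [Real.rpow_sub_one hr.ne'] at this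
    convert this using 1
    ring
  refine fun r hr => ⟨h r hr, ?_⟩
  have h2 : HasDerivAt (fun x => (-s * x ^ (-s)) / x) _ r :=
    ((h r hr).const_mul (-s)).div (hasDerivAt_id' r) hr.ne'
  refine h2.congr_deriv ?_
  field_simp
  ring

theorem C2p.contOn {f f1 f2 : ℝ → ℝ} (hf : C2p f f1 f2) : ContinuousOn f (Ioi 0) :=
  fun r hr => (hf r hr).1.continuousAt.continuousWithinAt

theorem C2p.of_contDiffOn {f : ℝ → ℝ} (hf : ContDiffOn ℝ 2 f (Ioi 0)) :
    C2p f (deriv f) (deriv (deriv f)) := by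
  intro r hr
  have h : ContDiffAt ℝ 2 f r := hf.contDiffAt (Ioi_mem_nhds hr)
  refine ⟨(h.differentiableAt (by norm_num)).hasDerivAt, ?_⟩
  have h2 : ContDiffOn ℝ 1 (deriv f) (Ioi 0) := hf.deriv_of_isOpen isOpen_Ioi (by norm_num)
  exact ((h2.contDiffAt (Ioi_mem_nhds hr)).differentiableAt (by norm_num)).hasDerivAt

theorem tangent_ineq {p x y : ℝ} (hp : 1 < p) (hx : 0 ≤ x) (hy : 0 ≤ y) :
    y ^ p - x ^ p ≤ p * y ^ (p - 1) * (y - x) := by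
  rcases hy.eq_or_lt with rfl | hy
  · rw [Real.zero_rpow (by linarith), Real.zero_rpow (by linarith)]
    have := Real.rpow_nonneg hx p
    linarith
  · have h := one_add_mul_self_le_rpow_one_add (s := x / y - 1)
      (by have : 0 ≤ x / y := by positivity
          linarith) hp.le
    have e : (1 + (x / y - 1)) ^ p = x ^ p / y ^ p := by
      rw [← Real.div_rpow hx hy.le]; ring_nf
    rw [e] at h
    have hyp : 0 < y ^ p := Real.rpow_pos_of_pos hy p
    rw [le_div_iff₀ hyp] at h
    rw [Real.rpow_sub_one hy.ne']
    have e2 : p * (y ^ p / y) * (y - x) = - (p * (x / y - 1) * y ^ p) := by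
      field_simp
      ring
    rw [e2]
    linarith

theorem localmax_second {F F1 : ℝ → ℝ} {F2 r : ℝ}
    (h1 : ∀ᶠ x in 𝓝 r, HasDerivAt F (F1 x) x) (h2 : HasDerivAt F1 F2 r)
    (hm : IsLocalMax F r) : F1 r = 0 ∧ F2 ≤ 0 := by
  have h0 : F1 r = 0 := hm.hasDerivAt_eq_zero h1.self_of_nhds
  refine ⟨h0, ?_⟩
  by_contra hc
  push Not at hc
  have e1 : deriv F =ᶠ[𝓝 r] F1 := h1.mono fun x hx => hx.deriv
  have e2 : deriv (deriv F) r = F2 := by rw [e1.deriv_eq, h2.deriv]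
  have hmin : IsLocalMin F r := isLocalMin_of_deriv_deriv_pos (by rw [e2]; exact hc)
    (by rw [e1.self_of_nhds, h0]) h1.self_of_nhds.continuousAt
  have hconst : F =ᶠ[𝓝 r] fun _ => F r := by
    filter_upwards [hm, hmin] with x a b
    exact le_antisymm a b
  have e3 : deriv F =ᶠ[𝓝 r] fun _ => 0 := by
    have := hconst.deriv
    simpa using this
  have : deriv (deriv F) r = 0 := by rw [e3.deriv_eq]; simp
  linarith

theorem localmax_C2p {F F1 F2 : ℝ → ℝ} (h : C2p F F1 F2) {r : ℝ} (hr : 0 < r)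
    (hm : IsLocalMax F r) : F1 r = 0 ∧ F2 r ≤ 0 :=
  localmax_second ((Ioi_mem_nhds hr : Ioi (0:ℝ) ∈ 𝓝 r) |> fun h' =>
    Filter.mem_of_superset h' (fun x hx => (h x hx).1)) (h r hr).2 hm

/-- general comparison -/
theorem comparison {n : ℕ} {p : ℝ} {v : ℝ → ℝ → ℝ} {v₀ : ℝ → ℝ} (hp : 1 < p)
    (hv : IsRadialSol n p v v₀) {r1 r2 t1 T : ℝ} (hr1 : 0 < r1) (ht1 : 0 ≤ t1)
    {f f1 f2 q q1 q2 g g1 g2 : ℝ → ℝ} {a d : ℝ} (hf : C2p f f1 f2) (hf0 : ∀ r > 0, 0 ≤ f r)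
    (hfs : ∀ r > 0, f2 r + ((n : ℝ) - 1) / r * f1 r + f r ^ p ≤ 0)
    (hq : C2p q q1 q2) (hg : C2p g g1 g2)
    (b1 : ∀ t ∈ Icc t1 T, v r1 t < f r1 + (exp (a * t) * q r1 + exp (d * t) * g r1))
    (b2 : ∀ t ∈ Icc t1 T, v r2 t < f r2 + (exp (a * t) * q r2 + exp (d * t) * g r2))
    (b0 : ∀ r ∈ Icc r1 r2, v r t1 < f r + (exp (a * t1) * q r + exp (d * t1) * g r))
    (key : ∀ r ∈ Ioo r1 r2, ∀ t ∈ Ioc t1 T,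
      v r t = f r + (exp (a * t) * q r + exp (d * t) * g r) →
      exp (a * t) * (q2 r + ((n : ℝ) - 1) / r * q1 r)
        + exp (d * t) * (g2 r + ((n : ℝ) - 1) / r * g1 r)
      < p * v r t ^ (p - 1) * ((a - 1) * (exp (a * t) * q r) + (d - 1) * (exp (d * t) * g r))) :
    ∀ r ∈ Icc r1 r2, ∀ t ∈ Icc t1 T, v r t < f r + (exp (a * t) * q r + exp (d * t) * g r) := by
  by_contra hcon
  push Not at hcon
  obtain ⟨r', hr', t', ht', hbad⟩ := hcon
  set w : ℝ → ℝ → ℝ := fun r t => f r + (exp (a * t) * q r + exp (d * t) * g r) with hw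
  set K : Set (ℝ × ℝ) := Icc r1 r2 ×ˢ Icc t1 T with hK
  have hKc : IsCompact K := isCompact_Icc.prod isCompact_Icc
  have hsub : Icc r1 r2 ⊆ Ioi (0:ℝ) := fun x hx => lt_of_lt_of_le hr1 hx.1
  have lift : ∀ {h : ℝ → ℝ}, ContinuousOn h (Ioi 0) → ContinuousOn (fun x : ℝ × ℝ => h x.1) K :=
    fun hh => hh.comp continuousOn_fst (fun x hx => hsub hx.1)
  have hwc : ContinuousOn (fun x : ℝ × ℝ => w x.1 x.2) K := by
    have e1 : ContinuousOn (fun x : ℝ × ℝ => exp (a * x.2)) K :=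
      (Continuous.continuousOn (by fun_prop))
    have e2 : ContinuousOn (fun x : ℝ × ℝ => exp (d * x.2)) K :=
      (Continuous.continuousOn (by fun_prop))
    exact (lift hf.contOn).add ((e1.mul (lift hq.contOn)).add (e2.mul (lift hg.contOn)))
  have hvc : ContinuousOn (fun x : ℝ × ℝ => v x.1 x.2) K :=
    hv.cont.mono (fun x hx => ⟨le_of_lt (show (0:ℝ) < x.1 from hsub hx.1), ht1.trans hx.2.1⟩)
  set S : Set (ℝ × ℝ) := {x ∈ K | w x.1 x.2 ≤ v x.1 x.2} with hS
  have hSc : IsCompact S := by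
    have : IsClosed S := hKc.isClosed.isClosed_le hwc hvc
    exact hKc.of_isClosed_subset this (fun x hx => hx.1)
  have hSne : S.Nonempty := ⟨(r', t'), ⟨hr', ht'⟩, hbad⟩
  obtain ⟨⟨r, t⟩, ⟨⟨hr, ht⟩, hle⟩, hmin⟩ := hSc.exists_isMinOn hSne
    (f := fun x : ℝ × ℝ => x.2) continuousOn_snd
  simp only at hr ht hle
  have hbefore : ∀ x ∈ Icc r1 r2, ∀ s ∈ Ico t1 t, v x s < w x s := by
    intro x hx s hs
    by_contra hc
    push Not at hc
    have := hmin (show (x, s) ∈ S from ⟨⟨hx, hs.1, hs.2.le.trans ht.2⟩, hc⟩)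
    simp only [mem_setOf_eq] at this
    linarith [hs.2]
  have htt : t1 < t := by
    rcases ht.1.eq_or_lt with h | h
    · subst h
      exact absurd (b0 r hr) (not_lt.mpr hle)
    · exact h
  have hrr : r ∈ Ioo r1 r2 := by
    refine ⟨lt_of_le_of_ne hr.1 ?_, lt_of_le_of_ne hr.2 ?_⟩
    · rintro rfl; exact absurd (b1 t ht) (not_lt.mpr hle)
    · rintro rfl; exact absurd (b2 t ht) (not_lt.mpr hle)
  have hr0 : 0 < r := hr1.trans hrr.1
  have ht0 : 0 < t := lt_of_le_of_lt ht1 htt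
  have hat : ∀ x ∈ Icc r1 r2, v x t ≤ w x t := by
    intro x hx
    have hmap : MapsTo (fun s : ℝ => (x, s)) (Icc t1 T) K := fun s hs => ⟨hx, hs⟩
    have cv : ContinuousOn (fun s => v x s) (Icc t1 T) :=
      hvc.comp (Continuous.continuousOn (by fun_prop)) hmap
    have cw : ContinuousOn (fun s => w x s) (Icc t1 T) :=
      hwc.comp (Continuous.continuousOn (by fun_prop)) hmap
    have hs : Ico t1 t ⊆ Icc t1 T := fun s hs => ⟨hs.1, hs.2.le.trans ht.2⟩
    have cv' := (cv t ht).mono hs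
    have cw' := (cw t ht).mono hs
    have hne : (𝓝[Ico t1 t] t).NeBot := by
      apply mem_closure_iff_nhdsWithin_neBot.mp
      rw [closure_Ico htt.ne]
      exact ⟨htt.le, le_rfl⟩
    exact le_of_tendsto_of_tendsto cv' cw'
      (eventually_mem_nhdsWithin.mono fun s hs => (hbefore x hx s hs).le)
  have heq : v r t = w r t := le_antisymm (hat r hr) hle
  have hvr : C2p (fun x => v x t) (deriv fun x => v x t) (deriv (deriv fun x => v x t)) :=
    C2p.of_contDiffOn ((hv.smooth_r t ht0).mono Ioi_subset_Ici_self)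
  have hwr : C2p (fun x => w x t) _ _ := hf.add ((hq.smul (exp (a * t))).add (hg.smul (exp (d * t))))
  have hmax : IsLocalMax (fun x => v x t - w x t) r := by
    filter_upwards [Icc_mem_nhds hrr.1 hrr.2] with x hx
    have := hat x hx
    rw [heq]; linarith
  obtain ⟨g1', g2'⟩ := localmax_C2p (hvr.sub hwr) hr0 hmax
  have hvt : HasDerivAt (fun s => v r s ^ p) (deriv (fun s => v r s ^ p) t) t :=
    (((hv.smooth_t r hr0.le).contDiffAt (Ioi_mem_nhds ht0)).differentiableAt
      (by norm_num)).hasDerivAt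
  have hE : ∀ c : ℝ, HasDerivAt (fun s => exp (c * s)) (c * exp (c * t)) t := by
    intro c
    have := ((hasDerivAt_id t).const_mul c).exp
    simpa [mul_comm] using this
  have hwt : HasDerivAt (fun s => w r s)
      ((a * exp (a * t)) * q r + (d * exp (d * t)) * g r) t :=
    (((hE a).mul_const (q r)).add ((hE d).mul_const (g r))).const_add (f r)
  have hwpt := hwt.rpow_const (p := p) (Or.inr hp.le)
  have hdt := hvt.sub hwpt
  have hge : 0 ≤ deriv (fun s => v r s ^ p) t -
      ((a * exp (a * t)) * q r + (d * exp (d * t)) * g r) * p * w r t ^ (p - 1) := by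
    by_contra hneg
    push Not at hneg
    have := hdt.hasDerivWithinAt (s := Iio t)
    have h2 := hasDerivWithinAt_iff_tendsto_slope' (by simp) |>.mp this
    have h3 : ∀ᶠ s in 𝓝[<] t, 0 ≤ slope (fun s => v r s ^ p - w r s ^ p) t s := by
      filter_upwards [Ico_mem_nhdsLT htt] with s hs
      rw [slope_def_field]
      apply div_nonneg_of_nonpos
      · have h4 := hbefore r hr s hs
        have h5 : v r s ^ p ≤ w r s ^ p :=
          Real.rpow_le_rpow (hv.nonneg r hr0.le s (ht1.trans hs.1)) h4.le (by linarith)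
        rw [heq]; linarith
      · linarith [hs.2]
    have := ge_of_tendsto h2 h3
    exact absurd this (not_le.mpr hneg)
  have hpde := hv.pde r hr0 t ht0
  have hk := key r hrr t ⟨htt, ht.2⟩ heq
  have hfs' := hfs r hr0
  have htan := tangent_ineq hp (hf0 r hr0) (hv.nonneg r hr0.le t ht0.le)
  rw [← heq] at hge
  have hH : v r t - f r = exp (a * t) * q r + exp (d * t) * g r := by
    rw [heq]; simp only [hw]; ring
  rw [hH] at htan
  have e1 : deriv (fun x => v x t) r = f1 r + (exp (a * t) * q1 r + exp (d * t) * g1 r) := by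
    linarith
  rw [hpde, e1] at hge
  set X := p * v r t ^ (p - 1) with hX
  have e2 : (a * exp (a * t) * q r + d * exp (d * t) * g r) * p * v r t ^ (p - 1) =
     X * (a * (exp (a * t) * q r) + d * (exp (d * t) * g r)) := by rw [hX]; ring
  rw [e2] at hge
  nlinarith
structure Par (n : ℕ) (p ν L γ : ℝ) : Prop where
  hp : 1 < p
  hν : 0 < ν
  hL : 0 < L
  hγ : ν < γ
  hQ : p * L ^ (p - 1) < γ * ((n : ℝ) - 2 - γ)
  hνp : ν * (p - 1) = 2
  hLs : L ^ (p - 1) = ν * ((n : ℝ) - 2 - ν)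

theorem lap_pow (n : ℕ) (s : ℝ) {r : ℝ} (hr : 0 < r) :
    s * (s + 1) * r ^ (-s) / r ^ 2 + ((n : ℝ) - 1) / r * (-s * r ^ (-s) / r) =
      -(s * ((n : ℝ) - 2 - s)) * (r ^ (-s) / r ^ 2) := by
  field_simp
  ring

section
variable {n : ℕ} {p ν L γ : ℝ}

theorem Par.inf_pow (P : Par n p ν L γ) {r : ℝ} (hr : 0 < r) :
    (L * r ^ (-ν)) ^ (p - 1) = L ^ (p - 1) / r ^ 2 := by
  rw [Real.mul_rpow P.hL.le (Real.rpow_nonneg hr.le _), ← Real.rpow_mul hr.le,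
    neg_mul, P.hνp, Real.rpow_neg hr.le, Real.rpow_ofNat]
  rfl

theorem Par.inf_pos (P : Par n p ν L γ) {r : ℝ} (hr : 0 < r) : 0 < L * r ^ (-ν) :=
  mul_pos P.hL (Real.rpow_pos_of_pos hr _)

theorem Par.vpow_le (P : Par n p ν L γ) {r x : ℝ} (hr : 0 < r) (hx : 0 ≤ x)
    (h : x ≤ L * r ^ (-ν)) : p * x ^ (p - 1) ≤ p * L ^ (p - 1) / r ^ 2 := by
  have := Real.rpow_le_rpow hx h (by linarith [P.hp] : 0 ≤ p - 1)
  rw [P.inf_pow hr] at this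
  rw [mul_div_assoc]
  exact mul_le_mul_of_nonneg_left this (by linarith [P.hp])

theorem Par.Qpos (P : Par n p ν L γ) : 0 < p * L ^ (p - 1) :=
  mul_pos (by linarith [P.hp]) (Real.rpow_pos_of_pos P.hL _)

theorem Par.γpos (P : Par n p ν L γ) : 0 < γ := P.hν.trans P.hγ

theorem Par.inf_eq (P : Par n p ν L γ) {r : ℝ} (hr : 0 < r) :
    L * (ν * (ν + 1) * r ^ (-ν) / r ^ 2) + ((n : ℝ) - 1) / r * (L * (-ν * r ^ (-ν) / r))
      + (L * r ^ (-ν)) ^ p = 0 := by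
  have h1 : (L * r ^ (-ν)) ^ p = (L * r ^ (-ν)) ^ (p - 1) * (L * r ^ (-ν)) := by
    rw [← Real.rpow_add_one (P.inf_pos hr).ne']; ring_nf
  rw [h1, P.inf_pow hr, P.hLs]
  have h2 := lap_pow n ν hr
  have : L * (ν * (ν + 1) * r ^ (-ν) / r ^ 2) + ((n : ℝ) - 1) / r * (L * (-ν * r ^ (-ν) / r))
    = L * (-(ν * ((n : ℝ) - 2 - ν)) * (r ^ (-ν) / r ^ 2)) := by rw [← h2]; ring
  rw [this]
  ring

end

theorem exists_small (M : ℝ) {c s r0 : ℝ} (hc : 0 < c) (hs : 0 < s) (hr0 : 0 < r0) :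
    ∃ r1, 0 < r1 ∧ r1 < r0 ∧ M < c * r1 ^ (-s) := by
  have h : Tendsto (fun r : ℝ => c * r ^ (-s)) (𝓝[>] 0) atTop :=
    (tendsto_rpow_neg_nhdsGT_zero (by linarith)).const_mul_atTop hc
  obtain ⟨r, h1, h2⟩ := ((h.eventually_gt_atTop M).and (Ioo_mem_nhdsGT hr0)).exists
  exact ⟨r, h2.1, h2.2, h1⟩

theorem exists_large {ε : ℝ} (hε : 0 < ε) (c r0 : ℝ) {s : ℝ} (hs : 0 < s) :
    ∃ r2, r0 < r2 ∧ c * r2 ^ (-s) < ε := by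
  have h : Tendsto (fun r : ℝ => c * r ^ (-s)) atTop (𝓝 (c * 0)) :=
    (tendsto_rpow_neg_atTop hs).const_mul c
  rw [mul_zero] at h
  obtain ⟨r, h1, h2⟩ := ((h.eventually_lt_const hε).and (eventually_gt_atTop r0)).exists
  exact ⟨r, h2, h1⟩

section
variable {n : ℕ} {p ν L γ : ℝ} {v : ℝ → ℝ → ℝ} {v₀ : ℝ → ℝ}

theorem stepA (P : Par n p ν L γ) (hv : IsRadialSol n p v v₀)
    (hu : ∀ r > (0 : ℝ), v₀ r ≤ L * r ^ (-ν)) :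
    ∀ r > 0, ∀ t ≥ 0, v r t ≤ L * r ^ (-ν) := by
  intro r hr t ht
  set A : ℝ := 1 + (n + 1) / (p * L ^ (p - 1)) with hA
  have hQ := P.Qpos
  have hn0 : (0 : ℝ) ≤ n := Nat.cast_nonneg n
  apply le_of_forall_pos_le_add
  intro ε' hε'
  set ε : ℝ := ε' / (exp (A * t) * r) with hε
  have hεp : 0 < ε := by positivity
  obtain ⟨M, hM⟩ := hv.bdd (t + 1) (by linarith)
  obtain ⟨r1, hr1, hr1r, h1⟩ := exists_small M P.hL P.hν hr
  set r2 : ℝ := max (r + 1) (M / ε + 1) with hr2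
  have hr2r : r < r2 := by have := le_max_left (r + 1) (M / ε + 1); linarith
  have hr2M : M < ε * r2 := by
    have h : M / ε < r2 := by have := le_max_right (r + 1) (M / ε + 1); linarith
    rw [div_lt_iff₀ hεp] at h; linarith
  have hr20 : 0 < r2 := hr.trans hr2r
  have hA1 : 1 < A := by rw [hA]; have : 0 < (n + 1) / (p * L ^ (p - 1)) := by positivity
                         linarith
  have hexp : ∀ s : ℝ, 0 ≤ s → 1 ≤ exp (A * s) := fun s hs =>
    Real.one_le_exp (by positivity)
  have := comparison (n := n) P.hp hv (r1 := r1) (r2 := r2) (t1 := 0) (T := t) hr1 le_rfl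
    (a := 0) (d := A) ((C2p.pow ν).smul L) (fun r hr => (P.inf_pos hr).le)
    (fun r hr => (P.inf_eq hr).le) (C2p.const 0) (C2p.id.smul ε)
    (by
      intro s hs
      have := hM r1 hr1.le s ⟨hs.1, by linarith [hs.2]⟩
      have : 0 < exp (A * s) * (ε * r1) := by positivity
      linarith)
    (by
      intro s hs
      have := hM r2 hr20.le s ⟨hs.1, by linarith [hs.2]⟩
      have h2 := P.inf_pos hr20
      have := hexp s hs.1
      have : ε * r2 ≤ exp (A * s) * (ε * r2) := le_mul_of_one_le_left (by positivity) this
      linarith)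
    (by
      intro x hx
      have hx0 : 0 < x := lt_of_lt_of_le hr1 hx.1
      rw [hv.init x hx0.le]
      have := hu x hx0
      have : 0 < exp (A * 0) * (ε * x) := by positivity
      linarith)
    (by
      intro x hx s hs heq
      have hx0 : 0 < x := hr1.trans hx.1
      have e : 0 < exp (A * s) * (ε * x) := by positivity
      have hge : L * x ^ (-ν) ≤ v x s := by linarith
      have h3 := Real.rpow_le_rpow (P.inf_pos hx0).le hge (by linarith [P.hp] : 0 ≤ p - 1)
      rw [P.inf_pow hx0] at h3
      have h4 : p * L ^ (p - 1) / x ^ 2 ≤ p * v x s ^ (p - 1) := by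
        rw [mul_div_assoc]; exact mul_le_mul_of_nonneg_left h3 (by linarith [P.hp])
      have h5 : p * L ^ (p - 1) / x ^ 2 * ((A - 1) * (exp (A * s) * (ε * x))) ≤
          p * v x s ^ (p - 1) * ((A - 1) * (exp (A * s) * (ε * x))) :=
        mul_le_mul_of_nonneg_right h4 (by
          have : 0 ≤ A - 1 := by linarith
          positivity)
      have h6 : p * L ^ (p - 1) / x ^ 2 * ((A - 1) * (exp (A * s) * (ε * x))) =
          (n + 1) * (exp (A * s) * ε) / x := by
        have : p * L ^ (p - 1) * (A - 1) = n + 1 := by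
          rw [hA, add_sub_cancel_left, mul_div_assoc', mul_div_cancel_left₀ _ hQ.ne']
        rw [← this]; field_simp
      have h7 : exp (A * s) * (ε * 0 + ((n : ℝ) - 1) / x * (ε * 1)) =
          (n - 1) * (exp (A * s) * ε) / x := by field_simp; ring
      have h8 : ((n : ℝ) - 1) * (exp (A * s) * ε) / x < (n + 1) * (exp (A * s) * ε) / x := by
        have : 0 < exp (A * s) * ε := by positivity
        gcongr
        linarith
      rw [h7]
      have : exp (0 * s) * (0 + ((n : ℝ) - 1) / x * 0) = 0 := by ring
      rw [this]
      have : (0 - 1) * (exp (0 * s) * 0) + (A - 1) * (exp (A * s) * (ε * x)) =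
        (A - 1) * (exp (A * s) * (ε * x)) := by ring
      rw [this]
      linarith)
    r ⟨hr1r.le, hr2r.le⟩ t ⟨ht, le_rfl⟩
  have e : exp (A * t) * (ε * r) = ε' := by rw [hε]; field_simp
  simp only [e, mul_zero, zero_add] at this
  exact this.le
end
section
variable {n : ℕ} {p ν L γ : ℝ} {v : ℝ → ℝ → ℝ} {v₀ : ℝ → ℝ}

theorem stepG (P : Par n p ν L γ) (hv : IsRadialSol n p v v₀)
    (hinf : ∀ r > 0, ∀ t ≥ 0, v r t ≤ L * r ^ (-ν))
    {f f1 f2 q q1 q2 : ℝ → ℝ} (hf : C2p f f1 f2) (hf0 : ∀ r > 0, 0 ≤ f r)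
    (hfs : ∀ r > 0, f2 r + ((n : ℝ) - 1) / r * f1 r + f r ^ p ≤ 0)
    (hq : C2p q q1 q2) {k c0 t1 R : ℝ} (hk : 0 ≤ k)
    (hkQ : (1 + k) * (p * L ^ (p - 1)) < γ * ((n : ℝ) - 2 - γ)) (hc0 : 0 ≤ c0) (ht1 : 0 ≤ t1)
    (hq0 : ∀ r ∈ Ioc 0 R, 0 ≤ q r)
    (hqs : ∀ r ∈ Ioo 0 R, ∀ t > t1,
      q2 r + ((n : ℝ) - 1) / r * q1 r + (1 + k) * (p * v r t ^ (p - 1)) * q r ≤ 0)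
    (bR : ∀ t ≥ t1, v R t ≤ f R + (exp (-k * t) * q R + exp (2 * t) * c0))
    (b0 : ∀ r ∈ Ioc 0 R, v r t1 ≤ f r + (exp (-k * t1) * q r + exp (2 * t1) * c0)) :
    ∀ r ∈ Ioc 0 R, ∀ t ≥ t1, v r t ≤ f r + (exp (-k * t) * q r + exp (2 * t) * c0) := by
  intro r hr t ht
  have hr0 : 0 < r := hr.1
  have hR0 : 0 < R := hr.1.trans_le hr.2
  apply le_of_forall_pos_le_add
  intro ε' hε'
  set ε : ℝ := ε' / (exp (-k * t) * r ^ (-γ)) with hε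
  have hεp : 0 < ε := by positivity
  obtain ⟨M, hM⟩ := hv.bdd (t + 1) (by linarith)
  obtain ⟨r1, hr1, hr1r, h1⟩ := exists_small M
    (show 0 < exp (-k * t) * ε by positivity) P.γpos hr.1
  have := comparison (n := n) P.hp hv (r1 := r1) (r2 := R) (t1 := t1) (T := t) hr1 ht1
    (a := -k) (d := 2) hf hf0 hfs (hq.add ((C2p.pow γ).smul ε)) (C2p.const c0)
    (by
      intro s hs
      have e1 := hM r1 hr1.le s ⟨ht1.trans hs.1, by linarith [hs.2]⟩
      have e2 := hq0 r1 ⟨hr1, by linarith [hr.2]⟩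
      have e3 := hf0 r1 hr1
      have e4 : exp (-k * t) ≤ exp (-k * s) := by
        apply Real.exp_le_exp.mpr
        nlinarith [hs.2]
      have e5 : exp (-k * t) * (ε * r1 ^ (-γ)) ≤ exp (-k * s) * (ε * r1 ^ (-γ)) :=
        mul_le_mul_of_nonneg_right e4 (by positivity)
      have e6 : 0 ≤ exp (-k * s) * q r1 := by positivity
      have e7 : 0 ≤ exp (2 * s) * c0 := by positivity
      rw [mul_add]
      linarith)
    (by
      intro s hs
      have := bR s hs.1
      have : 0 < exp (-k * s) * (ε * R ^ (-γ)) := by positivity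
      rw [mul_add]
      linarith)
    (by
      intro x hx
      have hx0 : 0 < x := lt_of_lt_of_le hr1 hx.1
      have := b0 x ⟨hx0, hx.2⟩
      have : 0 < exp (-k * t1) * (ε * x ^ (-γ)) := by positivity
      rw [mul_add]
      linarith)
    (by
      intro x hx s hs heq
      have hx0 : 0 < x := hr1.trans hx.1
      have hs0 : 0 ≤ s := ht1.trans hs.1.le
      have hX := P.vpow_le hx0 (hv.nonneg x hx0.le s hs0) (hinf x hx0 s hs0)
      have hX0 : 0 ≤ p * v x s ^ (p - 1) :=
        mul_nonneg (by linarith [P.hp]) (Real.rpow_nonneg (hv.nonneg x hx0.le s hs0) _)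
      have hq' := hqs x ⟨hx0, hx.2⟩ s hs.1
      set X := p * v x s ^ (p - 1) with hXdef
      have hl := lap_pow n γ hx0
      have e1 : q2 x + ε * (γ * (γ + 1) * x ^ (-γ) / x ^ 2) +
          ((n : ℝ) - 1) / x * (q1 x + ε * (-γ * x ^ (-γ) / x)) =
          (q2 x + ((n : ℝ) - 1) / x * q1 x)
            - ε * (γ * ((n : ℝ) - 2 - γ) / x ^ 2) * x ^ (-γ) := by
        have : ε * (γ * ((n : ℝ) - 2 - γ) / x ^ 2) * x ^ (-γ) =
          - ε * (-(γ * ((n : ℝ) - 2 - γ)) * (x ^ (-γ) / x ^ 2)) := by ring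
        rw [this, ← hl]; ring
      have e2 : (1 + k) * X < γ * ((n : ℝ) - 2 - γ) / x ^ 2 := by
        calc (1 + k) * X ≤ (1 + k) * (p * L ^ (p - 1) / x ^ 2) :=
              mul_le_mul_of_nonneg_left hX (by linarith)
          _ = (1 + k) * (p * L ^ (p - 1)) / x ^ 2 := by ring
          _ < _ := by gcongr
      have e3 : (1 + k) * X * (ε * x ^ (-γ)) < γ * ((n : ℝ) - 2 - γ) / x ^ 2 * (ε * x ^ (-γ)) :=
        mul_lt_mul_of_pos_right e2 (by positivity)
      have e4 : exp (-k * s) * ((q2 x + ((n : ℝ) - 1) / x * q1 x)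
            - ε * (γ * ((n : ℝ) - 2 - γ) / x ^ 2) * x ^ (-γ)) <
            exp (-k * s) * (- (1 + k) * X * (q x + ε * x ^ (-γ))) :=
        mul_lt_mul_of_pos_left (by linarith) (Real.exp_pos _)
      have e5 : 0 ≤ X * (exp (2 * s) * c0) := by positivity
      rw [e1]
      linarith)
    r ⟨hr1r.le, hr.2⟩ t ⟨ht, le_rfl⟩
  have e : exp (-k * t) * (ε * r ^ (-γ)) = ε' := by rw [hε]; field_simp
  rw [mul_add, e] at this
  linarith

theorem stepC (P : Par n p ν L γ) (hv : IsRadialSol n p v v₀)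
    (hinf : ∀ r > 0, ∀ t ≥ 0, v r t ≤ L * r ^ (-ν)) {M : ℝ} (hM : 0 < M)
    (hv0 : ∀ r > 0, v₀ r ≤ M) : ∀ r > 0, ∀ t ≥ 0, v r t ≤ exp (2 * t) * M := by
  intro r hr t ht
  obtain ⟨R, hR, hRM⟩ := exists_large hM L r P.hν
  have hR0 : 0 < R := hr.trans hR
  have h1 : ∀ t ≥ (0:ℝ), M ≤ exp (2 * t) * M := fun t ht =>
    le_mul_of_one_le_left hM.le (Real.one_le_exp (by linarith))
  have := stepG P hv hinf (k := 0) (c0 := M) (t1 := 0) (R := R) (C2p.const 0)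
    (fun _ _ => le_rfl) (fun r hr => by simp [Real.zero_rpow (by linarith [P.hp] : p ≠ 0)])
    (C2p.const 0) le_rfl
    (by linarith [P.hQ]) hM.le le_rfl (fun _ _ => le_rfl) (fun r _ t _ => by simp)
    (by
      intro t ht
      have := hinf R hR0 t ht
      have := h1 t ht
      simp only [mul_zero, zero_add]
      linarith)
    (by
      intro x hx
      rw [hv.init x hx.1.le]
      have := hv0 x hx.1
      have := h1 0 le_rfl
      simp only [mul_zero, zero_add] at this ⊢
      linarith) r ⟨hr, hR.le⟩ t ht
  simpa using this

theorem stepB (P : Par n p ν L γ) (hv : IsRadialSol n p v v₀)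
    (hinf : ∀ r > 0, ∀ t ≥ 0, v r t ≤ L * r ^ (-ν))
    {f f1 f2 : ℝ → ℝ} (hf : C2p f f1 f2) (hf0 : ∀ r > 0, 0 ≤ f r)
    (hfs : ∀ r > 0, f2 r + ((n : ℝ) - 1) / r * f1 r + f r ^ p ≤ 0)
    {k b : ℝ} (hk : 0 ≤ k) (hb : 0 ≤ b)
    (hkQ : (1 + k) * (p * L ^ (p - 1)) < γ * ((n : ℝ) - 2 - γ))
    (hv0 : ∀ r > 0, v₀ r ≤ f r + b * r ^ (-γ)) :
    ∀ r > 0, ∀ t ≥ 0, v r t ≤ f r + exp (-k * t) * (b * r ^ (-γ)) := by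
  intro r hr t ht
  apply le_of_forall_pos_le_add
  intro ε' hε'
  set ε : ℝ := ε' / exp (2 * t) with hε
  have hεp : 0 < ε := by positivity
  obtain ⟨R, hR, hRM⟩ := exists_large hεp L r P.hν
  have hR0 : 0 < R := hr.trans hR
  have h1 : ∀ t ≥ (0:ℝ), ε ≤ exp (2 * t) * ε := fun t ht =>
    le_mul_of_one_le_left hεp.le (Real.one_le_exp (by linarith))
  have := stepG P hv hinf (k := k) (c0 := ε) (t1 := 0) (R := R) hf hf0 hfs
    ((C2p.pow γ).smul b) hk hkQ hεp.le le_rfl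
    (fun x hx => mul_nonneg hb (Real.rpow_nonneg hx.1.le _))
    (by
      intro x hx s hs
      have hx0 : 0 < x := hx.1
      have hX := P.vpow_le hx0 (hv.nonneg x hx0.le s hs.le) (hinf x hx0 s hs.le)
      have hl := lap_pow n γ hx0
      set X := p * v x s ^ (p - 1) with hXdef
      have e2 : (1 + k) * X ≤ γ * ((n : ℝ) - 2 - γ) / x ^ 2 := by
        calc (1 + k) * X ≤ (1 + k) * (p * L ^ (p - 1) / x ^ 2) :=
              mul_le_mul_of_nonneg_left hX (by linarith)
          _ = (1 + k) * (p * L ^ (p - 1)) / x ^ 2 := by ring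
          _ ≤ _ := by gcongr
      have e3 : (1 + k) * X * (b * x ^ (-γ)) ≤ γ * ((n : ℝ) - 2 - γ) / x ^ 2 * (b * x ^ (-γ)) :=
        mul_le_mul_of_nonneg_right e2 (by positivity)
      have e4 : γ * ((n : ℝ) - 2 - γ) / x ^ 2 * (b * x ^ (-γ)) =
          - b * (-(γ * ((n : ℝ) - 2 - γ)) * (x ^ (-γ) / x ^ 2)) := by ring
      rw [e4, ← hl] at e3
      linarith)
    (by
      intro t ht
      have := hinf R hR0 t ht
      have := h1 t ht
      have := hf0 R hR0
      have : 0 ≤ exp (-k * t) * (b * R ^ (-γ)) := by positivity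
      linarith)
    (by
      intro x hx
      rw [hv.init x hx.1.le]
      have := hv0 x hx.1
      have := h1 0 le_rfl
      simp only [mul_zero, Real.exp_zero, one_mul] at this ⊢
      linarith) r ⟨hr, hR.le⟩ t ht
  have e : exp (2 * t) * ε = ε' := by rw [hε]; field_simp
  rw [e] at this
  linarith
end
section
variable {n : ℕ} {p ν L γ : ℝ}

theorem stepD (P : Par n p ν L γ) {δ R σ : ℝ} (hδ : 0 < δ) (hδR : δ < R) (hσ : 0 < σ) :
    ∃ η' > 0, ∀ (v : ℝ → ℝ → ℝ) (v₀ : ℝ → ℝ), IsRadialSol n p v v₀ →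
      (∀ r > 0, ∀ t ≥ 0, v r t ≤ L * r ^ (-ν)) →
      (∀ t ∈ Icc (0:ℝ) 1, v δ t ≤ L * δ ^ (-ν) - σ) →
      (∀ t ∈ Icc (0:ℝ) 1, v R t ≤ L * R ^ (-ν) - σ) →
      ∀ r ∈ Icc δ R, v r 1 ≤ L * r ^ (-ν) - η' := by
  have hQ := P.Qpos
  have hn0 : (0 : ℝ) ≤ n := Nat.cast_nonneg n
  have hR : 0 < R := hδ.trans hδR
  set A : ℝ := p * L ^ (p - 1) / δ ^ 2 * R + (n + 1) / δ with hA
  have hA0 : 0 < A := by positivity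
  set η : ℝ := σ / (2 * exp (1 + A * R)) with hη
  have hη0 : 0 < η := by positivity
  have hη1 : exp (1 + A * R) * η = σ / 2 := by rw [hη]; field_simp
  refine ⟨η * exp 1 * (1 - exp (-A * δ)), ?_, ?_⟩
  · have : exp (-A * δ) < 1 := by
      rw [← Real.exp_zero]
      exact Real.exp_lt_exp.mpr (by nlinarith)
    have : 0 < 1 - exp (-A * δ) := by linarith
    positivity
  intro v v₀ hv hinf hbδ hbR r hr
  have hbd : ∀ x, 0 < x → ∀ t ∈ Icc (0:ℝ) 1,
      -(σ / 2) ≤ exp ((1 + A * R) * t) * (-η * exp (-A * x)) := by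
    intro x hx t ht
    have e1 : exp ((1 + A * R) * t) ≤ exp (1 + A * R) := by
      apply Real.exp_le_exp.mpr
      have : 0 < 1 + A * R := by positivity
      nlinarith [ht.2]
    have e2 : exp (-A * x) ≤ 1 := Real.exp_le_one_iff.mpr (by nlinarith)
    have e3 : exp ((1 + A * R) * t) * (η * exp (-A * x)) ≤ exp (1 + A * R) * (η * 1) := by
      gcongr
    linarith
  have := comparison (n := n) P.hp hv (r1 := δ) (r2 := R) (t1 := 0) (T := 1) hδ le_rfl
    (a := 1 + A * R) (d := 1) ((C2p.pow ν).smul L) (fun r hr => (P.inf_pos hr).le)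
    (fun r hr => (P.inf_eq hr).le) ((C2p.exp A).smul (-η)) (C2p.const (η * exp (-A * δ)))
    (by
      intro t ht
      have := hbδ t ht
      have := hbd δ hδ t ht
      have : 0 < exp (1 * t) * (η * exp (-A * δ)) := by positivity
      linarith)
    (by
      intro t ht
      have := hbR t ht
      have := hbd R hR t ht
      have : 0 < exp (1 * t) * (η * exp (-A * δ)) := by positivity
      linarith)
    (by
      intro x hx
      rcases hx.1.eq_or_lt with rfl | hlt
      · have := hbδ 0 (by simp)
        have := hbd δ hδ 0 (by simp)
        have : 0 < exp (1 * 0) * (η * exp (-A * δ)) := by positivity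
        linarith
      · have h1 := hinf x (hδ.trans hlt) 0 le_rfl
        have h2 : exp (-A * x) < exp (-A * δ) := Real.exp_lt_exp.mpr (by nlinarith)
        have h3 : η * exp (-A * x) < η * exp (-A * δ) := mul_lt_mul_of_pos_left h2 hη0
        simp only [mul_zero, Real.exp_zero, one_mul]
        linarith)
    (by
      intro x hx s hs heq
      have hx0 : 0 < x := hδ.trans hx.1
      have hX := P.vpow_le hx0 (hv.nonneg x hx0.le s hs.1.le) (hinf x hx0 s hs.1.le)
      set X := p * v x s ^ (p - 1) with hXdef
      have h1 : X ≤ p * L ^ (p - 1) / δ ^ 2 := hX.trans (by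
        gcongr
        exact hx.1.le)
      have h2 : ((n : ℝ) - 1) / x < (n + 1) / δ := by
        calc ((n : ℝ) - 1) / x < (n + 1) / x := by gcongr; linarith
          _ ≤ _ := by
            gcongr
            exact hx.1.le
      have h3 : X * R + ((n : ℝ) - 1) / x < A := by
        have := mul_le_mul_of_nonneg_right h1 hR.le
        rw [hA]; linarith
      have h4 : 0 < (exp ((1 + A * R) * s) * (η * exp (-A * x)) * A) *
          (A - (X * R + ((n : ℝ) - 1) / x)) := mul_pos (by positivity) (by linarith)
      linarith)
    r hr 1 (by simp)
  have hE : exp ((1 + A * R) * 1) * (-η * exp (-A * r)) = -η * exp 1 * exp (A * (R - r)) := by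
    have : exp ((1 + A * R) * 1) * exp (-A * r) = exp 1 * exp (A * (R - r)) := by
      rw [← Real.exp_add, ← Real.exp_add]; ring_nf
    linear_combination (-η) * this
  rw [hE] at this
  have h5 : 1 ≤ exp (A * (R - r)) := Real.one_le_exp (mul_nonneg hA0.le (by linarith [hr.2]))
  have h6 : η * exp 1 * 1 ≤ η * exp 1 * exp (A * (R - r)) :=
    mul_le_mul_of_nonneg_left h5 (by positivity)
  rw [one_mul] at this
  linarith

structure St (n : ℕ) (p ν L : ℝ) (f f1 f2 : ℝ → ℝ) : Prop where
  cont : ContinuousOn f (Ici 0)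
  c2 : C2p f f1 f2
  eq : ∀ r > 0, f2 r + ((n : ℝ) - 1) / r * f1 r + f r ^ p = 0
  pos : ∀ r ≥ 0, 0 < f r
  anti : AntitoneOn f (Ici 0)
  upper : ∀ r > 0, f r ≤ L * r ^ (-ν)

theorem ordering (P : Par n p ν L γ) {f f1 f2 g g1 g2 : ℝ → ℝ} (hf : St n p ν L f f1 f2)
    (hg : St n p ν L g g1 g2) (h0 : f 0 < g 0) : ∀ r ≥ 0, f r < g r := by
  by_contra hcon
  push Not at hcon
  obtain ⟨r, hr, hbad⟩ := hcon
  have hsub : Icc 0 r ⊆ Ici (0:ℝ) := fun x hx => hx.1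
  set S : Set ℝ := {x ∈ Icc 0 r | g x ≤ f x} with hS
  have hSc : IsCompact S := isCompact_Icc.of_isClosed_subset
    (isClosed_Icc.isClosed_le (hg.cont.mono hsub) (hf.cont.mono hsub)) (fun x hx => hx.1)
  obtain ⟨r1, ⟨⟨hr10, hr1r⟩, hr1⟩, hmin⟩ := hSc.exists_isMinOn ⟨r, ⟨hr, le_rfl⟩, hbad⟩
    (f := fun x : ℝ => x) continuousOn_id
  have hbefore : ∀ x ∈ Ico 0 r1, f x < g x := by
    intro x hx
    by_contra hc
    push Not at hc
    have : r1 ≤ x := hmin (show x ∈ S from ⟨⟨hx.1, hx.2.le.trans hr1r⟩, hc⟩)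
    linarith [hx.2]
  have hr1p : 0 < r1 := by
    rcases hr10.eq_or_lt with h | h
    · rw [← h] at hr1; linarith
    · exact h
  have hzc : ContinuousOn (fun x : ℝ => x ^ γ * (g x - f x)) (Icc 0 r1) := by
    have hs : Icc 0 r1 ⊆ Ici (0:ℝ) := fun x hx => hx.1
    exact ((Real.continuous_rpow_const P.γpos.le).continuousOn).mul
      ((hg.cont.mono hs).sub (hf.cont.mono hs))
  obtain ⟨s, hs, hmax⟩ := isCompact_Icc.exists_isMaxOn ⟨0, le_rfl, hr10⟩ hzc
  set c : ℝ := s ^ γ * (g s - f s) with hc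
  have hmax' : ∀ x ∈ Icc 0 r1, x ^ γ * (g x - f x) ≤ c := fun x hx => hmax hx
  have hcpos : 0 < c := by
    have h1 := hmax' (r1 / 2) ⟨by linarith, by linarith⟩
    have h2 := hbefore (r1 / 2) ⟨by linarith, by linarith⟩
    have h3 : 0 < (r1 / 2) ^ γ := by positivity
    have := mul_pos h3 (sub_pos.mpr h2)
    linarith
  have hs0 : 0 < s := by
    rcases hs.1.eq_or_lt with h | h
    · rw [hc, ← h, Real.zero_rpow P.γpos.ne', zero_mul] at hcpos
      exact absurd hcpos (lt_irrefl _)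
    · exact h
  have hs1 : s < r1 := by
    rcases hs.2.eq_or_lt with h | h
    · exfalso
      have h3 : 0 < s ^ γ := by positivity
      have : g s - f s ≤ 0 := by rw [h]; linarith
      have := mul_nonpos_of_nonneg_of_nonpos h3.le this
      linarith
    · exact h
  have hws : g s - f s = c * s ^ (-γ) := by
    rw [hc, Real.rpow_neg hs0.le]
    have h3 : 0 < s ^ γ := by positivity
    field_simp
  have hF : IsLocalMax (fun x => (g x - f x) - c * x ^ (-γ)) s := by
    filter_upwards [Ioo_mem_nhds hs0 hs1] with x hx
    have hx0 : 0 < x := hx.1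
    have h1 := hmax' x ⟨hx.1.le, hx.2.le⟩
    have h3 : 0 < x ^ γ := by positivity
    have : g x - f x ≤ c * x ^ (-γ) := by
      rw [Real.rpow_neg hx0.le, ← div_eq_mul_inv, le_div_iff₀ h3]; linarith
    rw [hws]; linarith
  obtain ⟨k1, k2⟩ := localmax_C2p ((hg.c2.sub hf.c2).sub ((C2p.pow γ).smul c)) hs0 hF
  have hl := lap_pow n γ hs0
  have ef := hf.eq s hs0
  have eg := hg.eq s hs0
  have htan := tangent_ineq P.hp (hf.pos s hs0.le).le (hg.pos s hs0.le).le
  have hX := P.vpow_le hs0 (hg.pos s hs0.le).le (hg.upper s hs0)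
  have hw : 0 < g s - f s := sub_pos.mpr (hbefore s ⟨hs0.le, hs1⟩)
  have h1 : p * g s ^ (p - 1) * (g s - f s) ≤ p * L ^ (p - 1) / s ^ 2 * (g s - f s) :=
    mul_le_mul_of_nonneg_right hX hw.le
  have h2 : p * L ^ (p - 1) / s ^ 2 * (g s - f s)
      < γ * ((n : ℝ) - 2 - γ) / s ^ 2 * (g s - f s) := by
    have := P.hQ
    gcongr
  have h3 : γ * ((n : ℝ) - 2 - γ) / s ^ 2 * (g s - f s) =
    -(c * (-(γ * ((n : ℝ) - 2 - γ)) * (s ^ (-γ) / s ^ 2))) := by rw [hws]; ring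
  rw [h3, ← hl] at h2
  have k1' : ((n : ℝ) - 1) / s * (g1 s - f1 s - c * (-γ * s ^ (-γ) / s)) = 0 := by
    rw [k1, mul_zero]
  linarith

theorem St.scale (P : Par n p ν L γ) {f f1 f2 : ℝ → ℝ} (hf : St n p ν L f f1 f2) {μ : ℝ}
    (hμ : 0 < μ) : St n p ν L (fun r => μ ^ ν * f (μ * r)) (fun r => μ ^ ν * (μ * f1 (μ * r)))
      (fun r => μ ^ ν * (μ ^ 2 * f2 (μ * r))) := by
  have hm : 0 < μ ^ ν := by positivity
  have hlin : ∀ r, HasDerivAt (fun r => μ * r) μ r := fun r => by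
    simpa using (hasDerivAt_id r).const_mul μ
  refine ⟨?_, ?_, ?_, ?_, ?_, ?_⟩
  · refine continuousOn_const.mul (hf.cont.comp (by fun_prop) ?_)
    intro x hx
    exact mul_nonneg hμ.le hx
  · intro r hr
    have h := hf.c2 (μ * r) (by positivity)
    constructor
    · have := (h.1.comp r (hlin r)).const_mul (μ ^ ν)
      exact this.congr_deriv (by ring)
    · have := ((h.2.comp r (hlin r)).const_mul μ).const_mul (μ ^ ν)
      exact this.congr_deriv (by ring)
  · intro r hr
    have h := hf.eq (μ * r) (by positivity)
    have e1 : (μ ^ ν * f (μ * r)) ^ p = μ ^ ν * μ ^ 2 * f (μ * r) ^ p := by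
      rw [Real.mul_rpow hm.le (hf.pos _ (by positivity)).le, ← Real.rpow_mul hμ.le]
      have : ν * p = ν + 2 := by linarith [P.hνp]
      rw [this, Real.rpow_add hμ, Real.rpow_ofNat]
    rw [e1]
    have e2 : ((n : ℝ) - 1) / r * (μ ^ ν * (μ * f1 (μ * r))) =
        μ ^ ν * μ ^ 2 * (((n : ℝ) - 1) / (μ * r) * f1 (μ * r)) := by
      field_simp
    rw [e2]
    linear_combination (μ ^ ν * μ ^ 2) * h
  · intro r hr
    exact mul_pos hm (hf.pos _ (by positivity))
  · intro x hx y hy hxy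
    have hx' : 0 ≤ x := hx
    have hy' : 0 ≤ y := hy
    exact mul_le_mul_of_nonneg_left (hf.anti (mul_nonneg hμ.le hx') (mul_nonneg hμ.le hy')
      (mul_le_mul_of_nonneg_left hxy hμ.le)) hm.le
  · intro r hr
    have h := hf.upper (μ * r) (by positivity)
    have : μ ^ ν * (L * (μ * r) ^ (-ν)) = L * r ^ (-ν) := by
      rw [Real.mul_rpow hμ.le hr.le, Real.rpow_neg hμ.le]
      field_simp
    rw [← this]
    exact mul_le_mul_of_nonneg_left h hm.le
end
section
variable {n : ℕ} {p ν L γ : ℝ}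

theorem core (P : Par n p ν L γ) {f f1 f2 g g1 g2 : ℝ → ℝ} (hf : St n p ν L f f1 f2)
    (hg : St n p ν L g g1 g2) (h0 : f 0 < g 0)
    (hconv : Tendsto (fun s : ℝ => L - s ^ ν * f s) atTop (𝓝 0))
    (hfar : ∀ b : ℝ, 0 < b → ∃ R > 0, ∀ r ≥ R, f r + b * r ^ (-γ) ≤ g r)
    {v₀ : ℝ → ℝ} {b : ℝ} (hb : 0 < b) (hv₀cont : ContinuousOn v₀ (Set.Ici 0))
    (hv₀upper : ∀ r > (0 : ℝ), v₀ r ≤ L * r ^ (-ν))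
    (hv₀close : ∀ r > (1 : ℝ), v₀ r ≤ f r + b * r ^ (-γ)) :
    ∃ t₀ ≥ (0 : ℝ), ∀ v : ℝ → ℝ → ℝ, IsRadialSol n p v v₀ →
      ∀ r ≥ (0 : ℝ), ∀ t ≥ t₀, v r t ≤ g r := by
  have hL := P.hL
  have hQ := P.Qpos
  have hγ := P.γpos
  -- initial bound
  set b' : ℝ := b + L with hb'
  have hb'0 : 0 < b' := by positivity
  have hinit : ∀ r > 0, v₀ r ≤ f r + b' * r ^ (-γ) := by
    intro r hr
    have hpw : 0 < r ^ (-γ) := by positivity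
    rcases lt_or_ge 1 r with h | h
    · have := hv₀close r h
      have : 0 < L * r ^ (-γ) := by positivity
      rw [hb', add_mul]; linarith
    · have h1 := hv₀upper r hr
      have h2 : r ^ (-ν) ≤ r ^ (-γ) :=
        Real.rpow_le_rpow_of_exponent_ge hr h (by linarith [P.hγ])
      have h3 := mul_le_mul_of_nonneg_left h2 hL.le
      have : 0 < b * r ^ (-γ) := by positivity
      have := hf.pos r hr.le
      rw [hb', add_mul]; linarith
  -- k0
  obtain ⟨k0, hk0, hk0Q⟩ : ∃ k0 > 0, (1 + k0) * (p * L ^ (p - 1)) < γ * ((n : ℝ) - 2 - γ) := by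
    refine ⟨(γ * ((n : ℝ) - 2 - γ) - p * L ^ (p - 1)) / (2 * (p * L ^ (p - 1))), ?_, ?_⟩
    · have := sub_pos.mpr P.hQ
      positivity
    · have := P.hQ
      generalize p * L ^ (p - 1) = Q at *
      have : (1 + (γ * ((n : ℝ) - 2 - γ) - Q) / (2 * Q)) * Q =
        Q + (γ * ((n : ℝ) - 2 - γ) - Q) / 2 := by field_simp
      rw [this]; linarith
  -- R
  obtain ⟨R, hR, hRfar⟩ := hfar (b' + 1) (by positivity)
  have hRγ : 0 < R ^ (-γ) := by positivity
  -- M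
  obtain ⟨M, hM, hMv⟩ : ∃ M > 0, ∀ r > 0, v₀ r ≤ M := by
    obtain ⟨M0, hM0⟩ := (isCompact_Icc (a := (0:ℝ)) (b := 1)).bddAbove_image
      (hv₀cont.mono (fun x hx => hx.1))
    refine ⟨max M0 L, lt_max_of_lt_right hL, fun r hr => ?_⟩
    rcases le_or_gt r 1 with h | h
    · exact (hM0 ⟨r, ⟨hr.le, h⟩, rfl⟩).trans (le_max_left _ _)
    · refine (hv₀upper r hr).trans (le_trans ?_ (le_max_right _ _))
      have : r ^ (-ν) ≤ 1 := Real.rpow_le_one_of_one_le_of_nonpos h.le (by linarith [P.hν])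
      nlinarith
  obtain ⟨δ, hδ, hδR, hδM⟩ := exists_small (exp 2 * M + 1) hL P.hν hR
  set σ : ℝ := min 1 (R ^ (-γ)) with hσ
  have hσ0 : 0 < σ := lt_min one_pos hRγ
  have hσ1 : σ ≤ 1 := min_le_left _ _
  have hσ2 : σ ≤ R ^ (-γ) := min_le_right _ _
  obtain ⟨η, hη, hD⟩ := stepD P hδ hδR hσ0
  -- μ
  set τ : ℝ := min η σ with hτ
  have hτ0 : 0 < τ := lt_min hη hσ0
  obtain ⟨μ, hμ, hμc⟩ : ∃ μ > 0, ∀ r ≥ δ, L * r ^ (-ν) - τ < μ ^ ν * f (μ * r) := by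
    have hδν : 0 < δ ^ ν := by positivity
    obtain ⟨s0, hs0⟩ := eventually_atTop.mp
      (hconv.eventually_lt_const (show 0 < τ * δ ^ ν by positivity))
    refine ⟨max 1 (s0 / δ), by positivity, fun r hr => ?_⟩
    set μ : ℝ := max 1 (s0 / δ) with hμ
    have hμ0 : 0 < μ := by positivity
    have hr0 : 0 < r := hδ.trans_le hr
    have h1 : s0 ≤ μ * r := by
      have : s0 / δ ≤ μ := le_max_right _ _
      rw [div_le_iff₀ hδ] at this
      nlinarith
    have h2 := hs0 _ h1
    have h3 : δ ^ ν ≤ r ^ ν := Real.rpow_le_rpow hδ.le hr P.hν.le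
    rw [Real.mul_rpow hμ0.le hr0.le] at h2
    have hrν : 0 < r ^ ν := by positivity
    have h4 : L - μ ^ ν * r ^ ν * f (μ * r) < τ * r ^ ν :=
      h2.trans_le (mul_le_mul_of_nonneg_left h3 hτ0.le)
    have h5 : L * r ^ (-ν) * r ^ ν = L := by
      rw [Real.rpow_neg hr0.le]; field_simp
    by_contra hcon
    push Not at hcon
    have := mul_le_mul_of_nonneg_right hcon hrν.le
    rw [sub_mul, h5] at this
    linarith
  have S0 := hf.scale P hμ
  have S1 := hf.scale P (show 0 < 2 * μ by positivity)
  have S2 := hf.scale P (show 0 < 3 * μ by positivity)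
  have hf00 := hf.pos 0 le_rfl
  have O01 := ordering P S0 S1 (by
    simp only [mul_zero]
    have : μ ^ ν < (2 * μ) ^ ν := Real.rpow_lt_rpow hμ.le (by linarith) P.hν
    exact mul_lt_mul_of_pos_right this hf00)
  have O12 := ordering P S1 S2 (by
    simp only [mul_zero]
    have : (2 * μ) ^ ν < (3 * μ) ^ ν := Real.rpow_lt_rpow (by positivity) (by linarith) P.hν
    exact mul_lt_mul_of_pos_right this hf00)
  have O := ordering P hf hg h0
  generalize (fun r => μ ^ ν * (μ * f1 (μ * r))) = F01 at S0
  generalize (fun r => μ ^ ν * (μ ^ 2 * f2 (μ * r))) = F02 at S0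
  generalize (fun r => (2 * μ) ^ ν * (2 * μ * f1 (2 * μ * r))) = F11 at S1
  generalize (fun r => (2 * μ) ^ ν * ((2 * μ) ^ 2 * f2 (2 * μ * r))) = F12 at S1
  generalize (fun r => (3 * μ) ^ ν * (3 * μ * f1 (3 * μ * r))) = F21 at S2
  generalize (fun r => (3 * μ) ^ ν * ((3 * μ) ^ 2 * f2 (3 * μ * r))) = F22 at S2
  obtain ⟨F0, hF0⟩ : ∃ F0 : ℝ → ℝ, F0 = fun r => μ ^ ν * f (μ * r) := ⟨_, rfl⟩
  obtain ⟨F1, hF1⟩ : ∃ F1 : ℝ → ℝ, F1 = fun r => (2 * μ) ^ ν * f (2 * μ * r) := ⟨_, rfl⟩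
  obtain ⟨F2, hF2⟩ : ∃ F2 : ℝ → ℝ, F2 = fun r => (3 * μ) ^ ν * f (3 * μ * r) := ⟨_, rfl⟩
  rw [← hF0] at S0
  rw [← hF1] at S1
  rw [← hF2] at S2
  have O01 : ∀ r ≥ 0, F0 r < F1 r := by rw [hF0, hF1]; exact O01
  have O12 : ∀ r ≥ 0, F1 r < F2 r := by rw [hF1, hF2]; exact O12
  have hμc : ∀ r ≥ δ, L * r ^ (-ν) - τ < F0 r := by rw [hF0]; exact hμc
  clear hF0 hF1 hF2
  have hIcc : Icc 0 R ⊆ Ici (0:ℝ) := fun x hx => hx.1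
  have hne : (Icc 0 R).Nonempty := ⟨0, le_rfl, hR.le⟩
  -- ratio
  obtain ⟨k1, hk1, hk1r⟩ : ∃ k1 > 0, ∀ r ∈ Icc 0 R, (1 + k1) * F0 r ^ (p - 1) ≤ F1 r ^ (p - 1) := by
    have hp1 : 0 < p - 1 := by linarith [P.hp]
    have hc : ContinuousOn (fun r => F1 r ^ (p - 1) / F0 r ^ (p - 1)) (Icc 0 R) := by
      refine ContinuousOn.div ((S1.cont.mono hIcc).rpow_const fun x hx => Or.inr hp1.le)
        ((S0.cont.mono hIcc).rpow_const fun x hx => Or.inr hp1.le) ?_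
      intro x hx
      exact (Real.rpow_pos_of_pos (S0.pos x hx.1) _).ne'
    obtain ⟨x, hx, hmin⟩ := isCompact_Icc.exists_isMinOn hne hc
    refine ⟨F1 x ^ (p - 1) / F0 x ^ (p - 1) - 1, ?_, ?_⟩
    · have : F0 x ^ (p - 1) < F1 x ^ (p - 1) :=
        Real.rpow_lt_rpow (S0.pos x hx.1).le (O01 x hx.1) hp1
      have h2 : 0 < F0 x ^ (p - 1) := Real.rpow_pos_of_pos (S0.pos x hx.1) _
      have := (one_lt_div h2).mpr this
      linarith
    · intro r hr
      have h2 : 0 < F0 r ^ (p - 1) := Real.rpow_pos_of_pos (S0.pos r hr.1) _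
      have : F1 x ^ (p - 1) / F0 x ^ (p - 1) ≤ F1 r ^ (p - 1) / F0 r ^ (p - 1) := hmin hr
      rw [le_div_iff₀ h2] at this
      linarith
  set k : ℝ := min k0 k1 with hk
  have hkp : 0 < k := lt_min hk0 hk1
  have hkQ : (1 + k) * (p * L ^ (p - 1)) < γ * ((n : ℝ) - 2 - γ) := by
    have : k ≤ k0 := min_le_left _ _
    have : (1 + k) * (p * L ^ (p - 1)) ≤ (1 + k0) * (p * L ^ (p - 1)) :=
      mul_le_mul_of_nonneg_right (by linarith) hQ.le
    linarith
  have hkr : ∀ r ∈ Icc 0 R, (1 + k) * F0 r ^ (p - 1) ≤ F1 r ^ (p - 1) := by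
    intro r hr
    refine le_trans ?_ (hk1r r hr)
    have : k ≤ k1 := min_le_right _ _
    exact mul_le_mul_of_nonneg_right (by linarith) (Real.rpow_nonneg (S0.pos r hr.1).le _)
  -- psi bounds
  have hψc : ContinuousOn (fun r => F2 r - F1 r) (Icc 0 R) :=
    (S2.cont.mono hIcc).sub (S1.cont.mono hIcc)
  obtain ⟨m, hm, hmψ⟩ : ∃ m > 0, ∀ r ∈ Icc 0 R, m ≤ F2 r - F1 r := by
    obtain ⟨x, hx, hmin⟩ := isCompact_Icc.exists_isMinOn hne hψc
    exact ⟨F2 x - F1 x, sub_pos.mpr (O12 x hx.1), fun r hr => hmin hr⟩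
  obtain ⟨m', hm', hmg⟩ : ∃ m > 0, ∀ r ∈ Icc 0 R, m ≤ g r - f r := by
    obtain ⟨x, hx, hmin⟩ := isCompact_Icc.exists_isMinOn hne
      ((hg.cont.mono hIcc).sub (hf.cont.mono hIcc))
    exact ⟨g x - f x, sub_pos.mpr (O x hx.1), fun r hr => hmin hr⟩
  set K : ℝ := (b' * R ^ (-γ) + exp k * F0 0) / m with hK
  have hF00 := S0.pos 0 le_rfl
  have hK0 : 0 < K := by positivity
  have hKψ : ∀ r ∈ Icc 0 R, b' * R ^ (-γ) + exp k * F0 0 ≤ K * (F2 r - F1 r) := by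
    intro r hr
    have h1 : K * m = b' * R ^ (-γ) + exp k * F0 0 := by rw [hK]; field_simp
    rw [← h1]
    exact mul_le_mul_of_nonneg_left (hmψ r hr) hK0.le
  obtain ⟨Ψ, hΨ⟩ := isCompact_Icc.bddAbove_image hψc
  have hΨ' : ∀ r ∈ Icc 0 R, F2 r - F1 r ≤ Ψ := fun r hr => hΨ ⟨r, hr, rfl⟩
  -- time
  have htend : Tendsto (fun t : ℝ => exp (-k * t) * (K * Ψ)) atTop (𝓝 (0 * (K * Ψ))) := by
    refine Tendsto.mul_const _ ?_
    exact Real.tendsto_exp_atBot.comp (tendsto_id.const_mul_atTop_of_neg (by linarith))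
  rw [zero_mul] at htend
  obtain ⟨t', ht'⟩ := eventually_atTop.mp (htend.eventually_lt_const hm')
  refine ⟨max 1 t', le_trans zero_le_one (le_max_left _ _), ?_⟩
  intro v hv
  have hinf := stepA P hv hv₀upper
  have hC := stepC P hv hinf hM hMv
  have hB := stepB P hv hinf hf.c2 (fun r hr => (hf.pos r hr.le).le) (fun r hr => (hf.eq r hr).le)
    hkp.le hb'0.le hkQ hinit
  have hB' : ∀ r > 0, ∀ t ≥ 0, v r t ≤ f r + b' * r ^ (-γ) := by
    intro r hr t ht
    refine (hB r hr t ht).trans ?_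
    have : exp (-k * t) ≤ 1 := Real.exp_le_one_iff.mpr (by nlinarith)
    have := mul_le_of_le_one_left (show 0 ≤ b' * r ^ (-γ) by positivity) this
    linarith
  have hBR : ∀ t ≥ 0, v R t ≤ L * R ^ (-ν) - R ^ (-γ) := by
    intro t ht
    have h1 := hB' R hR t ht
    have h2 := hRfar R le_rfl
    have h3 := hg.upper R hR
    linarith
  have hsmall : ∀ r > 0, ∀ t ∈ Icc (0:ℝ) 1, v r t ≤ exp 2 * M := by
    intro r hr t ht
    refine (hC r hr t ht.1).trans ?_
    have : exp (2 * t) ≤ exp 2 := Real.exp_le_exp.mpr (by linarith [ht.2])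
    exact mul_le_mul_of_nonneg_right this hM.le
  have hD1 := hD v v₀ hv hinf
    (fun t ht => by have := hsmall δ hδ t ht; linarith)
    (fun t ht => by have := hBR t ht.1; linarith)
  -- E
  have hF0R : ∀ t ≥ 1, v R t ≤ F0 R := by
    intro t ht
    have h1 := hBR t (by linarith)
    have h2 := hμc R hδR.le
    have : τ ≤ σ := min_le_right _ _
    linarith
  have hF01 : ∀ r ∈ Ioc 0 R, v r 1 ≤ F0 r := by
    intro r hr
    rcases le_or_gt δ r with h | h
    · have h1 := hD1 r ⟨h, hr.2⟩
      have h2 := hμc r h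
      have : τ ≤ η := min_le_left _ _
      linarith
    · have h1 := hsmall r hr.1 1 (by simp)
      have h2 := hμc δ le_rfl
      have : τ ≤ σ := min_le_right _ _
      have h3 : F0 δ ≤ F0 r := S0.anti hr.1.le hδ.le h.le
      linarith
  have hE : ∀ r ∈ Ioc 0 R, ∀ t ≥ 1, v r t ≤ F0 r := by
    intro r hr t ht
    have := stepG P hv hinf (k := 0) (c0 := 0) (t1 := 1) (R := R) S0.c2
      (fun r hr => (S0.pos r hr.le).le) (fun r hr => (S0.eq r hr).le)
      (C2p.const 0) le_rfl (by linarith [P.hQ]) le_rfl zero_le_one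
      (fun _ _ => le_rfl) (fun r _ t _ => by simp)
      (fun t ht => by simpa using hF0R t ht) (fun r hr => by simpa using hF01 r hr) r hr t ht
    simpa using this
  have hFF : ∀ r ∈ Ioc 0 R, ∀ t ≥ 1, v r t ≤ f r + exp (-k * t) * (K * (F2 r - F1 r)) := by
    intro r hr t ht
    have := stepG P hv hinf (k := k) (c0 := 0) (t1 := 1) (R := R) hf.c2
      (fun r hr => (hf.pos r hr.le).le) (fun r hr => (hf.eq r hr).le)
      ((S2.c2.sub S1.c2).smul K) hkp.le hkQ le_rfl zero_le_one
      (fun x hx => mul_nonneg hK0.le (sub_pos.mpr (O12 x hx.1.le)).le)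
      (by
        intro x hx s hs
        have hx0 : 0 < x := hx.1
        have e1 := S1.eq x hx0
        have e2 := S2.eq x hx0
        have htan := tangent_ineq P.hp (S2.pos x hx0.le).le (S1.pos x hx0.le).le
        have hv0 := hv.nonneg x hx0.le s (by linarith)
        have h1 : v x s ^ (p - 1) ≤ F0 x ^ (p - 1) :=
          Real.rpow_le_rpow hv0 (hE x ⟨hx0, hx.2.le⟩ s hs.le) (by linarith [P.hp])
        have h2 : (1 + k) * v x s ^ (p - 1) ≤ F1 x ^ (p - 1) :=
          (mul_le_mul_of_nonneg_left h1 (by linarith)).trans (hkr x ⟨hx0.le, hx.2.le⟩)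
        have hψ : 0 < F2 x - F1 x := sub_pos.mpr (O12 x hx0.le)
        have h3 : (1 + k) * v x s ^ (p - 1) * (p * (F2 x - F1 x)) ≤
            F1 x ^ (p - 1) * (p * (F2 x - F1 x)) :=
          mul_le_mul_of_nonneg_right h2 (mul_nonneg (by linarith [P.hp]) hψ.le)
        have h4 : (F22 x - F12 x) + ((n : ℝ) - 1) / x * (F21 x - F11 x)
          + (1 + k) * (p * v x s ^ (p - 1)) * (F2 x - F1 x) ≤ 0 := by linarith
        have h5 := mul_nonpos_of_nonneg_of_nonpos hK0.le h4
        linarith)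
      (by
        intro s hs
        have h1 := hB R hR s (by linarith)
        have h2 := hKψ R ⟨hR.le, le_rfl⟩
        have h3 : b' * R ^ (-γ) ≤ K * (F2 R - F1 R) := by
          have : 0 < exp k * F0 0 := by positivity
          linarith
        have := mul_le_mul_of_nonneg_left h3 (Real.exp_pos (-k * s)).le
        linarith)
      (by
        intro x hx
        have h1 := hF01 x hx
        have h2 : F0 x ≤ F0 0 := S0.anti (le_refl (0:ℝ)) hx.1.le hx.1.le
        have h3 := hKψ x ⟨hx.1.le, hx.2⟩
        have h4 : exp k * F0 0 ≤ K * (F2 x - F1 x) := by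
          have : 0 < b' * R ^ (-γ) := by positivity
          linarith
        have h5 := mul_le_mul_of_nonneg_left h4 (Real.exp_pos (-k * 1)).le
        have h6 : exp (-k * 1) * (exp k * F0 0) = F0 0 := by
          rw [← mul_assoc, ← Real.exp_add]; simp
        have := hf.pos x hx.1.le
        linarith) r hr t ht
    simpa using this
  have hfinal : ∀ r > 0, ∀ t ≥ max 1 t', v r t ≤ g r := by
    intro r hr t ht
    have ht1 : 1 ≤ t := (le_max_left _ _).trans ht
    have ht2 : t' ≤ t := (le_max_right _ _).trans ht
    rcases le_or_gt r R with h | h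
    · have h1 := hFF r ⟨hr, h⟩ t ht1
      have h2 := ht' t ht2
      have h3 := hmg r ⟨hr.le, h⟩
      have h4 : exp (-k * t) * (K * (F2 r - F1 r)) ≤ exp (-k * t) * (K * Ψ) := by
        have := hΨ' r ⟨hr.le, h⟩
        gcongr
      linarith
    · have h1 := hB' r hr t (by linarith)
      have h2 := hRfar r h.le
      have : 0 < r ^ (-γ) := by positivity
      linarith
  intro r hr t ht
  rcases (show 0 ≤ r from hr).eq_or_lt with h | h
  · subst h
    have ht0 : 0 ≤ t := by
      have := (le_max_left 1 t').trans ht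
      linarith
    have cv : ContinuousOn (fun x => v x t) (Ici 0) :=
      hv.cont.comp (f := fun x : ℝ => (x, t)) (Continuous.continuousOn (by fun_prop))
        (fun x hx => ⟨hx, ht0⟩)
    have c1 := (cv 0 self_mem_Ici).mono (Ioi_subset_Ici_self)
    have c2 := (hg.cont 0 self_mem_Ici).mono (Ioi_subset_Ici_self)
    exact le_of_tendsto_of_tendsto c1 c2
      (eventually_mem_nhdsWithin.mono fun x hx => hfinal x hx t ht)
  · exact hfinal r h t ht
end
theorem par_basic {n : ℕ} (hn : 10 < n) {p : ℝ} (hp : pc n < p) :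
    1 < p ∧ 2 * nuExp p < (n : ℝ) - 2 := by
  have hn' : (11 : ℝ) ≤ n := by exact_mod_cast hn
  set q : ℝ := Real.sqrt ((n : ℝ) - 1) with hq
  have hq2 : q ^ 2 = n - 1 := Real.sq_sqrt (by linarith)
  have hq3 : 3 < q := by
    rw [hq]; apply Real.lt_sqrt_of_sq_lt; linarith
  have hnq : (n : ℝ) = q ^ 2 + 1 := by linarith
  unfold pc at hp
  rw [← hq, div_lt_iff₀ (mul_pos (by linarith) (by linarith)), hnq] at hp
  have h1 : 0 < ((p - 1) * ((q + 1) * (q - 3)) - 4) * ((q + 3) * (q - 1)) := by nlinarith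
  have h2 : 0 < (q + 3) * (q - 1) := mul_pos (by linarith) (by linarith)
  have h3 : 4 < (p - 1) * ((q + 1) * (q - 3)) := by
    have := (pos_iff_pos_of_mul_pos h1).mpr h2
    linarith
  have h4 : 0 < (q + 1) * (q - 3) := mul_pos (by linarith) (by linarith)
  have h5 : 0 < p - 1 := by
    by_contra hc
    push Not at hc
    have := mul_nonpos_of_nonpos_of_nonneg hc h4.le
    linarith
  refine ⟨by linarith, ?_⟩
  unfold nuExp
  have : 2 / (p - 1) * 2 < (q + 1) * (q - 3) := by
    rw [div_mul_eq_mul_div, div_lt_iff₀ h5]; linarith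
  nlinarith

theorem par_main {n : ℕ} (hn : 10 < n) {p γ : ℝ} (hp : pc n < p)
    (hγ : γ ∈ Set.Ioo (nuExp p + lam1 n p) (((n : ℝ) - 2) / 2)) :
    0 < lam1 n p ∧ Par n p (nuExp p) (Lconst n p) γ := by
  obtain ⟨hp1, hν2⟩ := par_basic hn hp
  have hνp : nuExp p * (p - 1) = 2 := by
    unfold nuExp
    have : p - 1 ≠ 0 := by linarith
    field_simp
  have hν : 0 < nuExp p := by
    unfold nuExp
    have : 0 < p - 1 := by linarith
    positivity
  have hL1 : 0 < nuExp p * ((n : ℝ) - 2 - nuExp p) := mul_pos hν (by linarith)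
  have hL : 0 < Lconst n p := Real.rpow_pos_of_pos hL1 _
  have hLs : Lconst n p ^ (p - 1) = nuExp p * ((n : ℝ) - 2 - nuExp p) := by
    unfold Lconst
    rw [← Real.rpow_mul hL1.le, one_div_mul_cancel (by linarith), Real.rpow_one]
  obtain ⟨h1, h2⟩ := hγ
  unfold lam1 at h1 ⊢
  generalize nuExp p = ν at *
  generalize Lconst n p = L at *
  set D : ℝ := ((n : ℝ) - 2 - 2 * ν) ^ 2 - 8 * ((n : ℝ) - 2 - ν) with hD
  set s : ℝ := Real.sqrt D with hs
  have hs0 : 0 < s := by linarith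
  have hD0 : 0 < D := Real.sqrt_pos.mp hs0
  have hs2 : s ^ 2 = D := Real.sq_sqrt hD0.le
  have hsl : s < (n : ℝ) - 2 - 2 * ν := by
    apply lt_of_pow_lt_pow_left₀ 2 (by linarith)
    rw [hs2, hD]; linarith
  refine ⟨by linarith, hp1, hν, hL, by linarith, ?_, hνp, hLs⟩
  rw [hLs]
  have e1 : p * ν = ν + 2 := by linarith
  have e2 : p * (ν * ((n : ℝ) - 2 - ν)) = (ν + 2) * ((n : ℝ) - 2 - ν) := by
    rw [← mul_assoc, e1]
  rw [e2]
  have hγs : ((n : ℝ) - 2 - 2 * γ) ^ 2 < s ^ 2 := by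
    apply pow_lt_pow_left₀ (by linarith) (by linarith) two_ne_zero
  rw [hs2, hD] at hγs
  nlinarith

theorem IsSteadyStateA.toSt {n : ℕ} {p α a : ℝ} {φ : ℝ → ℝ} (h : IsSteadyStateA n p α φ a) :
    St n p (nuExp p) (Lconst n p) φ (deriv φ) (deriv (deriv φ)) :=
  ⟨h.cont, C2p.of_contDiffOn h.smooth, h.ode, h.pos, h.anti.antitoneOn, h.upper⟩

/-- Lemma 3.3: under the hypotheses of Lemma 3.2, for any `α' > α`
(with steady state `φ'` whose expansion coefficient `a'` satisfies `a' < a`, since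
`α ↦ a_α` is strictly decreasing) one can find `t₀ ≥ 0` such that every bounded classical
radial solution `v` with initial data `v₀` satisfies `v(r,t) ≤ φ_{α'}(r)` for all `r ≥ 0`
and `t ≥ t₀`. -/
theorem radial_eventually_below_larger_steady_state (n : ℕ) (hn : 10 < n) (p α b γ : ℝ)
    (hp : pc n < p) (hα : 0 < α) (hb : 0 < b)
    (hγ : γ ∈ Set.Ioo (nuExp p + lam1 n p) (((n : ℝ) - 2) / 2))
    (φ : ℝ → ℝ) (a : ℝ) (hφ : IsSteadyStateA n p α φ a)
    (v₀ : ℝ → ℝ) (hv₀cont : ContinuousOn v₀ (Set.Ici 0))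
    (hv₀nonneg : ∀ r > (0 : ℝ), 0 ≤ v₀ r)
    (hv₀upper : ∀ r > (0 : ℝ), v₀ r ≤ Lconst n p * r ^ (-nuExp p))
    (hv₀ge : ∀ r ≥ (0 : ℝ), φ r ≤ v₀ r)
    (hv₀close : ∀ r > (1 : ℝ), v₀ r ≤ φ r + b * r ^ (-γ)) :
    ∀ α' > α, ∀ (φ' : ℝ → ℝ) (a' : ℝ), IsSteadyStateA n p α' φ' a' → a' < a →
      ∃ t₀ ≥ (0 : ℝ), ∀ v : ℝ → ℝ → ℝ, IsRadialSol n p v v₀ →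
        ∀ r ≥ (0 : ℝ), ∀ t ≥ t₀, v r t ≤ φ' r := by
  intro α' hα' φ' a' hφ' haa
  obtain ⟨hlam, P⟩ := par_main hn hp hγ
  have hex := hφ.expansion.tendsto_div_nhds_zero
  have hex' := hφ'.expansion.tendsto_div_nhds_zero
  have h0 : φ 0 < φ' 0 := by rw [hφ.val0, hφ'.val0]; exact hα'
  have hγ1 := hγ.1
  refine core P hφ.toSt hφ'.toSt h0 ?_ ?_ hb hv₀cont hv₀upper hv₀close
  · generalize nuExp p = ν at *
    generalize Lconst n p = L at *
    generalize lam1 n p = l at *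
    have h1 := (tendsto_rpow_neg_atTop hlam).mul (hex.const_sub a)
    rw [zero_mul] at h1
    refine h1.congr' ?_
    filter_upwards [eventually_gt_atTop 0] with r hr
    have e1 : r ^ (-ν - l) = r ^ (-ν) * r ^ (-l) := by
      rw [← Real.rpow_add hr]; ring_nf
    have e2 : r ^ (-ν) * r ^ ν = 1 := by
      rw [← Real.rpow_add hr]; simp
    have p1 : 0 < r ^ (-ν) := by positivity
    have p2 : 0 < r ^ (-l) := by positivity
    have e3 : r ^ ν = 1 / r ^ (-ν) := by field_simp; linarith
    rw [e1, e3]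
    field_simp
    ring
  · intro c hc
    generalize nuExp p = ν at *
    generalize Lconst n p = L at *
    generalize lam1 n p = l at *
    have hg : Tendsto (fun r : ℝ => c * r ^ (-(γ - (ν + l)))) atTop (𝓝 (c * 0)) :=
      (tendsto_rpow_neg_atTop (by linarith)).const_mul c
    have h1 := (((hex'.sub hex).add_const (a - a')).sub hg).eventually_const_lt
      (show 0 < 0 - 0 + (a - a') - c * 0 by linarith)
    obtain ⟨R, hR⟩ := eventually_atTop.mp h1
    refine ⟨max R 1, by positivity, fun r hr => ?_⟩
    have hr0 : 0 < r := lt_of_lt_of_le one_pos ((le_max_right _ _).trans hr)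
    have h2 := hR r ((le_max_left _ _).trans hr)
    have e1 : r ^ (-γ) = r ^ (-(γ - (ν + l))) * r ^ (-ν - l) := by
      rw [← Real.rpow_add hr0]; ring_nf
    have p1 : 0 < r ^ (-ν - l) := by positivity
    have h3 := mul_pos h2 p1
    have e4 : ((φ' r - (L * r ^ (-ν) - a' * r ^ (-ν - l))) / r ^ (-ν - l) -
          (φ r - (L * r ^ (-ν) - a * r ^ (-ν - l))) / r ^ (-ν - l) + (a - a') -
          c * r ^ (-(γ - (ν + l)))) * r ^ (-ν - l) =
        φ' r - φ r - c * (r ^ (-(γ - (ν + l))) * r ^ (-ν - l)) := by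
      field_simp
      ring
    rw [e4, ← e1] at h3
    linarith
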